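/- arXiv:math/0001148 — 9 statements merged into one kernel-verified Lean document; each statement's English description precedes it below -/
import Mathlib

section
/- Let P be a partial order and A ⊆ P* a separating subset. For p ∈ P let ⟨p⟩_A denote the intersection of all A-ideals containing p, and [p⟩_A the intersection of all A-filters containing p. If ⟨p⟩_A ∩ [q⟩_A = ∅ for all p, q ∈ P with q ≰ p, then A is full. -/
open Set

variable {P : Type*}

/-- `UP_A(p) = {x ∈ A : x p = 1}`, as a subset of the subtype `↥A`. -/
def UPa [PartialOrder P] (A : Set (P →o Bool)) (p : P) : Set ↥A := {x | x.1 p = true}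

/-- `LO_A(p) = {x ∈ A : x p = 0}`, as a subset of the subtype `↥A`. -/
def LOa [PartialOrder P] (A : Set (P →o Bool)) (p : P) : Set ↥A := {x | x.1 p = false}

/-- The closure operator generated by a family `K` of subsets of `M`:
`C(X) = ⋂ {k ∈ K : X ⊆ k}` (the empty intersection being `M`). -/
def closGen {M : Type*} (K : Set (Set M)) (X : Set M) : Set M := ⋂₀ {k ∈ K | X ⊆ k}

/-- The closure `C1` on `A` generated by `{UP_A(p) : p ∈ P}`. -/
def C1a [PartialOrder P] (A : Set (P →o Bool)) : Set ↥A → Set ↥A :=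
  closGen (Set.range (UPa A))

/-- The closure `C2` on `A` generated by `{LO_A(p) : p ∈ P}`. -/
def C2a [PartialOrder P] (A : Set (P →o Bool)) : Set ↥A → Set ↥A :=
  closGen (Set.range (LOa A))

/-- `C1O2(A)`: the subsets of `A` that are `C1`-closed and `C2`-open. -/
def C1O2 [PartialOrder P] (A : Set (P →o Bool)) : Set (Set ↥A) :=
  {B | C1a A B = B ∧ C2a A Bᶜ = Bᶜ}

/-- An `A`-ideal: an intersection of kernels of elements of some `S ⊆ A`. -/
def IsIdealOf [PartialOrder P] (A : Set (P →o Bool)) (I : Set P) : Prop :=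
  ∃ S ⊆ A, I = ⋂ x ∈ S, {p : P | x p = false}

/-- An `A`-filter: an intersection of co-kernels of elements of some `S ⊆ A`. -/
def IsFilterOf [PartialOrder P] (A : Set (P →o Bool)) (F : Set P) : Prop :=
  ∃ S ⊆ A, F = ⋂ x ∈ S, {p : P | x p = true}

/-- `A` is full: for all `p ≰ q` some `x ∈ A` has `x p = 1`, `x q = 0`. -/
def IsFullSet [PartialOrder P] (A : Set (P →o Bool)) : Prop :=
  ∀ p q : P, ¬ p ≤ q → ∃ x ∈ A, x p = true ∧ x q = false

/-- `A` is separating: any disjoint `A`-ideal and `A`-filter are separated by some `x ∈ A`. -/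
def IsSeparatingSet [PartialOrder P] (A : Set (P →o Bool)) : Prop :=
  ∀ I F : Set P, IsIdealOf A I → IsFilterOf A F → I ∩ F = ∅ →
    ∃ x ∈ A, (∀ p ∈ I, x p = false) ∧ (∀ p ∈ F, x p = true)

/-- `⟨p⟩_A`: the intersection of all `A`-ideals containing `p`. -/
def idealGen [PartialOrder P] (A : Set (P →o Bool)) (p : P) : Set P :=
  ⋂₀ {I | IsIdealOf A I ∧ p ∈ I}

/-- `[p⟩_A`: the intersection of all `A`-filters containing `p`. -/
def filterGen [PartialOrder P] (A : Set (P →o Bool)) (p : P) : Set P :=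
  ⋂₀ {F | IsFilterOf A F ∧ p ∈ F}

theorem isIdealOf_idealGen [PartialOrder P] (A : Set (P →o Bool)) (p : P) :
    IsIdealOf A (idealGen A p) := by
  refine ⟨{x ∈ A | x p = false}, fun x hx => hx.1, ?_⟩
  apply Subset.antisymm
  · exact sInter_subset_of_mem
      ⟨⟨_, fun x hx => hx.1, rfl⟩, mem_iInter₂.2 fun x hx => hx.2⟩
  · rintro r hr _ ⟨⟨S, hS, rfl⟩, hp⟩
    exact mem_iInter₂.2 fun x hx =>
      mem_iInter₂.1 hr x ⟨hS hx, mem_iInter₂.1 hp x hx⟩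

theorem isFilterOf_filterGen [PartialOrder P] (A : Set (P →o Bool)) (p : P) :
    IsFilterOf A (filterGen A p) := by
  refine ⟨{x ∈ A | x p = true}, fun x hx => hx.1, ?_⟩
  apply Subset.antisymm
  · exact sInter_subset_of_mem
      ⟨⟨_, fun x hx => hx.1, rfl⟩, mem_iInter₂.2 fun x hx => hx.2⟩
  · rintro r hr _ ⟨⟨S, hS, rfl⟩, hp⟩
    exact mem_iInter₂.2 fun x hx =>
      mem_iInter₂.1 hr x ⟨hS hx, mem_iInter₂.1 hp x hx⟩

theorem mem_idealGen_self [PartialOrder P] (A : Set (P →o Bool)) (p : P) :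
    p ∈ idealGen A p := fun _ hI => hI.2

theorem mem_filterGen_self [PartialOrder P] (A : Set (P →o Bool)) (p : P) :
    p ∈ filterGen A p := fun _ hF => hF.2

/-- if `A` is separating and `⟨p⟩_A ∩ [q⟩_A = ∅` whenever `q ≰ p`,
then `A` is full. -/
theorem stmt0 [PartialOrder P] (A : Set (P →o Bool))
    (hsep : IsSeparatingSet A)
    (h : ∀ p q : P, ¬ q ≤ p → idealGen A p ∩ filterGen A q = ∅) :
    IsFullSet A := by
  intro p q hpq
  obtain ⟨x, hxA, hx0, hx1⟩ := hsep _ _ (isIdealOf_idealGen A q) (isFilterOf_filterGen A p)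
    (h q p hpq)
  exact ⟨x, hxA, hx1 p (mem_filterGen_self A p), hx0 q (mem_idealGen_self A q)⟩
end

section
/- Let P be a partial order and A ⊆ P* a separating subset. Then for every B ∈ C1O2(A) there exists p ∈ P with B = UP_A(p); that is, the map p ↦ UP_A(p) is surjective onto C1O2(A). -/
open Set

variable {P : Type*}

/-- if `A` is separating then every `B ∈ C1O2(A)` equals `UP_A(p)`
for some `p`. -/
theorem stmt3 [PartialOrder P] (A : Set (P →o Bool)) (hsep : IsSeparatingSet A) :
    ∀ B ∈ C1O2 A, ∃ p : P, UPa A p = B := by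
  rintro B ⟨hB₁, hB₂⟩
  by_cases h : ∃ p : P, (∀ x ∈ B, x.1 p = true) ∧ ∀ x ∈ Bᶜ, x.1 p = false
  · obtain ⟨p, hpT, hpF⟩ := h
    refine ⟨p, Set.ext fun x => ⟨fun hx => ?_, hpT x⟩⟩
    by_contra hxB
    exact absurd ((hpF x hxB).symm.trans hx) Bool.false_ne_true
  · obtain ⟨x, hxA, hxI, hxF⟩ := hsep
      (⋂ x ∈ (Subtype.val '' Bᶜ : Set (P →o Bool)), {p : P | x p = false})
      (⋂ x ∈ (Subtype.val '' B : Set (P →o Bool)), {p : P | x p = true})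
      ⟨_, Subtype.coe_image_subset A _, rfl⟩ ⟨_, Subtype.coe_image_subset A _, rfl⟩ (by
        refine Set.eq_empty_of_forall_notMem fun p hp => h ⟨p, fun x hx => ?_, fun x hx => ?_⟩
        · exact Set.mem_iInter₂.1 hp.2 x.1 (Set.mem_image_of_mem _ hx)
        · exact Set.mem_iInter₂.1 hp.1 x.1 (Set.mem_image_of_mem _ hx))
    have hxB : (⟨x, hxA⟩ : ↥A) ∈ B := by
      rw [← hB₁]
      rintro _ ⟨⟨p, rfl⟩, hp⟩
      refine hxF p (Set.mem_iInter₂.2 ?_)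
      rintro _ ⟨y, hy, rfl⟩
      exact hp hy
    have hxBc : (⟨x, hxA⟩ : ↥A) ∈ Bᶜ := by
      rw [← hB₂]
      rintro _ ⟨⟨p, rfl⟩, hp⟩
      refine hxI p (Set.mem_iInter₂.2 ?_)
      rintro _ ⟨y, hy, rfl⟩
      exact hp hy
    exact absurd hxB hxBc
end

section
/- Let P be a partial order and A ⊆ P* a full and separating subset. Then the map p ↦ UP_A(p) is an order isomorphism from P onto C1O2(A) ordered by set inclusion: it is a bijection and p ≤ q if and only if UP_A(p) ⊆ UP_A(q). -/
open Set

variable {P : Type*}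

theorem mem_closGen {M : Type*} {K : Set (Set M)} {X : Set M} {m : M} :
    m ∈ closGen K X ↔ ∀ k ∈ K, X ⊆ k → m ∈ k := by
  simp [closGen, and_imp]

theorem closGen_eq_self {M : Type*} {K : Set (Set M)} {X : Set M} (hX : X ∈ K) :
    closGen K X = X :=
  Subset.antisymm (fun _ hm => mem_closGen.1 hm X hX Subset.rfl)
    (fun _ hm => mem_closGen.2 fun _ _ hk => hk hm)

theorem compl_UPa [PartialOrder P] (A : Set (P →o Bool)) (p : P) : (UPa A p)ᶜ = LOa A p := by
  ext x
  simp [UPa, LOa]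

theorem UPa_mem_C1O2 [PartialOrder P] (A : Set (P →o Bool)) (p : P) : UPa A p ∈ C1O2 A := by
  refine ⟨closGen_eq_self (mem_range_self p), ?_⟩
  rw [compl_UPa]
  exact closGen_eq_self (mem_range_self p)

theorem le_iff_UPa_subset [PartialOrder P] {A : Set (P →o Bool)} (hfull : IsFullSet A) (p q : P) :
    p ≤ q ↔ UPa A p ⊆ UPa A q := by
  refine ⟨fun h x hx => ?_, fun h => ?_⟩
  · exact top_le_iff.1 ((show x.1 p = ⊤ from hx) ▸ x.1.monotone h)
  · by_contra hpq
    obtain ⟨x, hxA, hxp, hxq⟩ := hfull p q hpq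
    have hx : x q = true := @h ⟨x, hxA⟩ hxp
    simp [hxq] at hx

theorem exists_UPa_eq [PartialOrder P] {A : Set (P →o Bool)} (hsep : IsSeparatingSet A)
    {B : Set ↥A} (hB : B ∈ C1O2 A) : ∃ p : P, UPa A p = B := by
  obtain ⟨hB1, hB2⟩ := hB
  by_contra! hne
  obtain ⟨x, hxA, hxI, hxF⟩ := hsep _ _
    ⟨Subtype.val '' Bᶜ, Subtype.coe_image_subset A Bᶜ, rfl⟩
    ⟨Subtype.val '' B, Subtype.coe_image_subset A B, rfl⟩ (by
      refine eq_empty_of_forall_notMem fun p ⟨hpI, hpF⟩ => hne p ?_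
      simp only [biInter_image, mem_iInter] at hpI hpF
      refine Subset.antisymm (fun y hy => ?_) fun y hy => hpF y hy
      by_contra hyB
      exact absurd ((show y.1 p = true from hy).symm.trans (hpI y hyB)) (by decide))
  have hx1 : (⟨x, hxA⟩ : ↥A) ∈ B := by
    rw [← hB1]
    refine mem_closGen.2 ?_
    rintro _ ⟨p, rfl⟩ hp
    refine hxF p ?_
    simp only [biInter_image, mem_iInter]
    exact fun y hy => hp hy
  have hx2 : (⟨x, hxA⟩ : ↥A) ∈ Bᶜ := by
    rw [← hB2]
    refine mem_closGen.2 ?_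
    rintro _ ⟨p, rfl⟩ hp
    refine hxI p ?_
    simp only [biInter_image, mem_iInter]
    exact fun y hy => hp hy
  exact hx2 hx1

/-- if `A` is full and separating, then `p ↦ UP_A(p)` is an order
isomorphism from `P` onto `C1O2(A)` ordered by inclusion: it maps into `C1O2(A)`,
is injective and surjective onto `C1O2(A)`, and `p ≤ q ↔ UP_A(p) ⊆ UP_A(q)`. -/
theorem stmt4 [PartialOrder P] (A : Set (P →o Bool))
    (hfull : IsFullSet A) (hsep : IsSeparatingSet A) :
    (∀ p : P, UPa A p ∈ C1O2 A) ∧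
    Function.Injective (UPa A) ∧
    (∀ B ∈ C1O2 A, ∃ p : P, UPa A p = B) ∧
    (∀ p q : P, p ≤ q ↔ UPa A p ⊆ UPa A q) := by
  refine ⟨UPa_mem_C1O2 A, fun p q h => ?_, fun B hB => exists_UPa_eq hsep hB,
    le_iff_UPa_subset hfull⟩
  exact le_antisymm ((le_iff_UPa_subset hfull p q).2 h.subset)
    ((le_iff_UPa_subset hfull q p).2 h.superset)
end

section
/- For any orthoposet P, the orthodual space P*′ is full and separating (with ideals and filters taken with respect to P*′). -/
open Set

variable {P : Type*}

/-- An orthocomplementation on a bounded poset: antitone, involutive, and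
`⊤` is the least upper bound of `{p, p′}` while `⊥` is the greatest lower bound. -/
def IsOrtho [PartialOrder P] [BoundedOrder P] (oc : P → P) : Prop :=
  Antitone oc ∧ (∀ p, oc (oc p) = p) ∧
    (∀ p, IsLUB {p, oc p} ⊤) ∧ (∀ p, IsGLB {p, oc p} ⊥)

/-- The orthodual space `P*′`: monotone maps with `x(p′) = 1 - x(p)`. -/
def OrthoDual [PartialOrder P] (oc : P → P) : Set (P →o Bool) :=
  {x | ∀ p, x (oc p) = ! x p}

/-- A nonempty set no two of whose members are orthogonal lies in the co-kernel of an element of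
the orthodual space. -/
theorem exists_mem_orthoDual_of_pairwise_not_le [PartialOrder P] [BoundedOrder P] {oc : P → P}
    (hoc : IsOrtho oc) {S : Set P} (hne : S.Nonempty) (hS : ∀ p ∈ S, ∀ q ∈ S, ¬ p ≤ oc q) :
    ∃ x ∈ OrthoDual oc, ∀ p ∈ S, x p = true := by
  classical
  obtain ⟨anti, inv, -, glb⟩ := hoc
  obtain ⟨M, hSM, hM⟩ := zorn_subset_nonempty {M : Set P | ∀ p ∈ M, ∀ q ∈ M, ¬ p ≤ oc q}
    (by
      intro c hc hchain _
      refine ⟨⋃₀ c, ?_, fun s hs => subset_sUnion_of_mem hs⟩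
      rintro p ⟨s, hs, hps⟩ q ⟨t, ht, hqt⟩
      rcases hchain.total hs ht with hst | hts
      · exact hc ht p (hst hps) q hqt
      · exact hc hs p hps q (hts hqt)) S hS
  have orth : ∀ p ∈ M, ∀ q ∈ M, ¬ p ≤ oc q := hM.prop
  have swap : ∀ {p q : P}, p ≤ oc q → q ≤ oc p := fun {p q} h => by
    simpa only [inv] using anti h
  have eq_bot : ∀ {p : P}, p ≤ oc p → p = ⊥ := fun {p} h =>
    le_bot_iff.1 ((glb p).2 (by simp [lowerBounds, h]))
  have mem_of : ∀ r, ¬ r ≤ oc r → (∀ q ∈ M, ¬ q ≤ oc r) → r ∈ M := by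
    intro r hr hq
    refine hM.le_of_ge (y := insert r M) ?_ (subset_insert r M) (mem_insert r M)
    rintro a (rfl | ha) b (rfl | hb)
    · exact hr
    · exact fun h => hq b hb (swap h)
    · exact hq a ha
    · exact orth a ha b hb
  have upper : ∀ p ∈ M, ∀ r, p ≤ r → r ∈ M := by
    intro p hp r hpr
    refine mem_of r (fun h => ?_) (fun q hq h => orth q hq p hp (h.trans (anti hpr)))
    have hp_bot : p = ⊥ := le_bot_iff.1 (hpr.trans (eq_bot h).le)
    exact orth p hp p hp (hp_bot ▸ bot_le)
  have compl_mem : ∀ p, oc p ∈ M ↔ p ∉ M := by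
    intro p
    refine ⟨fun h hp => orth _ h p hp le_rfl, fun hp => ?_⟩
    by_contra hocp
    refine hp (mem_of p (fun h => ?_) (fun q hq h => hocp (upper q hq _ h)))
    obtain ⟨s, hs⟩ := hne
    refine hocp (upper s (hSM hs) _ (swap ?_))
    rw [eq_bot h]
    exact bot_le
  refine ⟨⟨fun p => decide (p ∈ M), fun p q hpq => ?_⟩, fun p => ?_, fun p hp => ?_⟩
  · by_cases hp : p ∈ M
    · simp [hp, upper p hp q hpq]
    · simp [hp]
  · change decide (oc p ∈ M) = !decide (p ∈ M)
    simp [compl_mem p]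
  · exact decide_eq_true (hSM hp)

/-- Elements of the orthodual space of an orthoposet preserve `⊥` and `⊤`. -/
theorem apply_bot_top_of_mem_orthoDual [PartialOrder P] [BoundedOrder P] {oc : P → P}
    {x : P →o Bool} (hx : x ∈ OrthoDual oc) : x ⊥ = false ∧ x ⊤ = true := by
  have h₁ := hx ⊥
  have h₂ : x ⊥ ≤ x (oc ⊥) := x.monotone bot_le
  have h₃ : x (oc ⊥) ≤ x ⊤ := x.monotone le_top
  revert h₁ h₂ h₃
  generalize x ⊥ = a
  generalize x (oc ⊥) = b
  generalize x ⊤ = c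
  revert a b c
  decide

/-- for any orthoposet, the orthodual space `P*′` is full and separating. -/
theorem stmt8 [PartialOrder P] [BoundedOrder P] (oc : P → P) (hoc : IsOrtho oc) :
    IsFullSet (OrthoDual oc) ∧ IsSeparatingSet (OrthoDual oc) := by 
  have ⟨anti, inv, lub, glb⟩ := hoc
  refine ⟨fun p q hpq => ?_, ?_⟩
  · obtain ⟨x, hx, h⟩ := exists_mem_orthoDual_of_pairwise_not_le hoc
      (S := {p, oc q}) ⟨p, by simp⟩ (by
        rintro a (rfl | rfl) b (rfl | rfl) hab
        · have : b ≤ ⊥ := (glb b).2 (by simp [lowerBounds, hab])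
          exact hpq (this.trans bot_le)
        · exact hpq (by simpa only [inv] using hab)
        · exact hpq (by simpa only [inv] using anti hab)
        · have : ⊤ ≤ q := (lub q).2 (by simpa [upperBounds, inv] using hab)
          exact hpq (le_top.trans this))
    refine ⟨x, hx, h p (by simp), ?_⟩
    have := h (oc q) (by simp)
    rw [hx q] at this
    simpa using this
  · rintro I F ⟨S, hS, rfl⟩ ⟨T, hT, rfl⟩ hdisj
    have disj : ∀ p, (∀ x ∈ S, x p = false) → ¬ ∀ x ∈ T, x p = true := fun p hI hF =>
      eq_empty_iff_forall_notMem.1 hdisj p ⟨by simpa using hI, by simpa using hF⟩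
    have bot_mem : ∀ x ∈ S, x ⊥ = false := fun x hx => (apply_bot_top_of_mem_orthoDual (hS hx)).1
    have top_mem : ∀ x ∈ T, x ⊤ = true := fun x hx => (apply_bot_top_of_mem_orthoDual (hT hx)).2
    obtain ⟨s, hs⟩ : S.Nonempty := nonempty_iff_ne_empty.2 fun h =>
      disj ⊤ (by simp [h]) top_mem
    obtain ⟨t, ht⟩ : T.Nonempty := nonempty_iff_ne_empty.2 fun h =>
      disj ⊥ bot_mem (by simp [h])
    have not_le : ∀ p q, (∀ x ∈ T, x p = true) → (∀ x ∈ S, x q = false) → ¬ p ≤ q :=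
      fun p q hp hq hpq => disj p
        (fun x hx => le_bot_iff.1 ((x.monotone hpq).trans (hq x hx).le)) hp
    obtain ⟨x, hx, h⟩ := exists_mem_orthoDual_of_pairwise_not_le hoc
      (S := {p | ∀ x ∈ T, x p = true} ∪ {p | ∀ x ∈ S, x (oc p) = false}) ⟨⊤, Or.inl top_mem⟩ (by
        rintro a (ha | ha) b (hb | hb) hab
        · have := t.monotone hab
          rw [ha t ht, hT ht b, hb t ht] at this
          exact absurd this (by decide)
        · exact not_le a (oc b) ha hb hab
        · exact not_le b (oc a) hb ha (by simpa only [inv] using anti hab)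
        · have h_le := s.monotone hab
          have h_compl := hS hs a
          rw [ha s hs] at h_compl
          rw [hb s hs] at h_le
          revert h_compl h_le
          generalize s a = u
          revert u
          decide)
    refine ⟨x, hx, fun p hp => ?_, fun p hp => h p (Or.inl (by simpa using hp))⟩
    have := h (oc p) (Or.inr (by simpa [inv] using hp))
    rw [hx p] at this
    simpa using this
end

section
/- Let P be a bounded partial order and let 𝒮 be the collection of subsets A ⊆ P* that are full, separating, and on which the generated closures C1 and C2 coincide. Then the map sending an orthocomplementation ′ on P to its orthodual space P*′ is a bijection from the set of orthocomplementations on P onto the set of maximal elements of 𝒮 with respect to set inclusion. -/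
open Set

variable {P : Type*}

theorem closGen_of_mem {M : Type*} {K : Set (Set M)} {k : Set M} (hk : k ∈ K) :
    closGen K k = k :=
  Subset.antisymm (fun _ hm => mem_closGen.1 hm k hk Subset.rfl)
    fun _ hm => mem_closGen.2 fun _ _ h => h hm

theorem map_eq_true_of_le [PartialOrder P] (x : P →o Bool) {p q : P} (h : p ≤ q)
    (hp : x p = true) : x q = true := by
  have := x.monotone h
  rw [hp] at this
  exact top_le_iff.1 this

theorem IsFullSet.le_of_forall [PartialOrder P] {A : Set (P →o Bool)} (hA : IsFullSet A) {p q : P}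
    (h : ∀ x ∈ A, x p = true → x q = true) : p ≤ q := by
  by_contra hpq
  obtain ⟨x, hx, hp, hq⟩ := hA p q hpq
  simp [h x hx hp] at hq

/-- For a separating `A`, every `C1`-closed and `C2`-open subset of `A` is some `UP_A(p)`. -/
theorem IsSeparatingSet.exists_eq_UPa [PartialOrder P] {A : Set (P →o Bool)}
    (hA : IsSeparatingSet A) {B : Set ↥A} (hB : B ∈ C1O2 A) : ∃ p, B = UPa A p := by
  obtain ⟨h1, h2⟩ := hB
  set F : Set P := ⋂ x ∈ Subtype.val '' B, {p : P | x p = true} with hF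
  set I : Set P := ⋂ x ∈ Subtype.val '' Bᶜ, {p : P | x p = false} with hI
  have mF {p : P} : p ∈ F ↔ ∀ x ∈ B, x.1 p = true := by
    simp only [hF, mem_iInter, forall_mem_image, mem_ofPred_eq]
  have mI {p : P} : p ∈ I ↔ ∀ x ∈ Bᶜ, x.1 p = false := by
    simp only [hI, mem_iInter, forall_mem_image, mem_ofPred_eq]
  by_cases hd : I ∩ F = ∅
  · obtain ⟨x, hxA, hxI, hxF⟩ := hA I F ⟨_, by simp, hI⟩ ⟨_, by simp, hF⟩ hd
    exfalso
    by_cases hx : (⟨x, hxA⟩ : ↥A) ∈ B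
    · have hx' : (⟨x, hxA⟩ : ↥A) ∈ C2a A Bᶜ := mem_closGen.2 <| by
        rintro _ ⟨q, rfl⟩ hq
        exact hxI q (mI.2 fun y hy => hq hy)
      rw [h2] at hx'
      exact hx' hx
    · apply hx
      rw [← h1]
      refine mem_closGen.2 ?_
      rintro _ ⟨q, rfl⟩ hq
      exact hxF q (mF.2 fun y hy => hq hy)
  · obtain ⟨p, hpI, hpF⟩ := nonempty_iff_ne_empty.2 hd
    refine ⟨p, Subset.antisymm (mF.1 hpF) fun x hx => ?_⟩
    by_contra hxB
    have := mI.1 hpI x hxB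
    rw [show x.1 p = true from hx] at this
    cases this

/-- A full separating set on which `C1 = C2` lies in the orthodual of some orthocomplementation. -/
theorem exists_isOrtho_subset_orthoDual [PartialOrder P] [BoundedOrder P] {A : Set (P →o Bool)}
    (hf : IsFullSet A) (hs : IsSeparatingSet A) (hC : C1a A = C2a A) :
    ∃ oc : P → P, IsOrtho oc ∧ A ⊆ OrthoDual oc := by
  have hex : ∀ p, ∃ q, LOa A p = UPa A q := fun p => hs.exists_eq_UPa <| by
    refine ⟨?_, ?_⟩
    · rw [hC]
      exact closGen_of_mem ⟨p, rfl⟩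
    · rw [← compl_UPa, compl_compl, ← hC]
      exact closGen_of_mem ⟨p, rfl⟩
  choose oc hoc using hex
  have hdual : ∀ x ∈ A, ∀ p, x (oc p) = ! x p := fun x hx p => by
    have := Set.ext_iff.1 (hoc p) ⟨x, hx⟩
    simp only [LOa, UPa, mem_ofPred_eq] at this
    cases h : x p <;> simp_all
  refine ⟨oc, ⟨?_, ?_, ?_, ?_⟩, hdual⟩
  · refine fun p q hpq => hf.le_of_forall fun x hx h => ?_
    rw [hdual x hx] at h ⊢
    by_contra hp
    have := map_eq_true_of_le x hpq (by simpa using hp)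
    simp [this] at h
  · intro p
    apply le_antisymm <;> refine hf.le_of_forall fun x hx h => ?_ <;>
      simpa [hdual x hx] using h
  · refine fun p => ⟨fun _ _ => le_top, fun q hq => hf.le_of_forall fun x hx _ => ?_⟩
    have hp : p ≤ q := hq (by simp)
    have hp' : oc p ≤ q := hq (by simp)
    cases h : x p
    · exact map_eq_true_of_le x hp' (by simp [hdual x hx, h])
    · exact map_eq_true_of_le x hp h
  · refine fun p => ⟨fun _ _ => bot_le, fun q hq => hf.le_of_forall fun x hx h => ?_⟩
    have hp : q ≤ p := hq (by simp)
    have hp' : q ≤ oc p := hq (by simp)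
    have h1 := map_eq_true_of_le x hp h
    have h2 := map_eq_true_of_le x hp' h
    simp [hdual x hx, h1] at h2

theorem IsOrtho.eq_bot [PartialOrder P] [BoundedOrder P] {oc : P → P} (h : IsOrtho oc) {p : P}
    (hp : p ≤ oc p) : p = ⊥ :=
  le_bot_iff.1 ((h.2.2.2 p).2 (by simp [lowerBounds, hp]))

theorem IsOrtho.eq_top [PartialOrder P] [BoundedOrder P] {oc : P → P} (h : IsOrtho oc) {p : P}
    (hp : oc p ≤ p) : p = ⊤ :=
  top_le_iff.1 ((h.2.2.1 p).2 (by simp [upperBounds, hp]))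

/-- An up-set containing no pair `r, r′` extends to an element of the orthodual. -/
theorem IsOrtho.exists_mem_orthoDual [PartialOrder P] [BoundedOrder P] [Nontrivial P] {oc : P → P}
    (h : IsOrtho oc) {U : Set P} (hU : IsUpperSet U) (hc : ∀ r ∈ U, oc r ∉ U) :
    ∃ x ∈ OrthoDual oc, ∀ p ∈ U, x p = true := by
  obtain ⟨M, hUM, hM⟩ := zorn_subset_nonempty {V : Set P | IsUpperSet V ∧ ∀ r ∈ V, oc r ∉ V}
    (fun c hcS hchain _ => ⟨⋃₀ c, ⟨isUpperSet_sUnion fun s hs => (hcS hs).1, by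
      rintro r ⟨s, hs, hrs⟩ ⟨t, ht, hrt⟩
      rcases hchain.total hs ht with hst | hts
      · exact (hcS ht).2 r (hst hrs) hrt
      · exact (hcS hs).2 r hrs (hts hrt)⟩, fun s hs => subset_sUnion_of_mem hs⟩) U ⟨hU, hc⟩
  obtain ⟨⟨hMup, hMc⟩, hmax⟩ := hM
  have hadd : ∀ r, ¬ r ≤ oc r → oc r ∉ M → r ∈ M := by
    intro r hr hr'
    refine hmax (y := M ∪ Ici r) ⟨hMup.union (isUpperSet_Ici r), ?_⟩ subset_union_left
      (Or.inr le_rfl)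
    rintro s (hs | hs) (hs' | hs')
    · exact hMc s hs hs'
    · refine hr' (hMup ?_ hs)
      have := h.1 hs'
      rwa [h.2.1] at this
    · exact hr' (hMup (h.1 hs) hs')
    · exact hr (le_trans hs' (h.1 hs))
  have htot : ∀ r, oc r ∉ M → r ∈ M := by
    intro r hr'
    by_cases hr : r ≤ oc r
    · exfalso
      refine hr' (hadd (oc r) (fun hle => ?_) ?_)
      · rw [h.2.1] at hle
        exact bot_ne_top ((h.eq_bot hr).symm.trans (h.eq_top hle))
      · rw [h.2.1]
        exact fun hrM => hr' (hMup hr hrM)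
    · exact hadd r hr hr'
  classical
  refine ⟨⟨fun p => decide (p ∈ M), fun p q hpq => ?_⟩, fun p => ?_, fun p hp => ?_⟩
  · by_cases hp : p ∈ M
    · simp [hp, hMup hpq hp]
    · simp [hp]
  · change decide (oc p ∈ M) = ! decide (p ∈ M)
    by_cases hp : p ∈ M
    · simp [hp, hMc p hp]
    · simpa [hp] using not_imp_comm.1 (htot p) hp
  · exact decide_eq_true (hUM hp)

theorem IsOrtho.isFullSet_orthoDual [PartialOrder P] [BoundedOrder P] {oc : P → P}
    (h : IsOrtho oc) : IsFullSet (OrthoDual oc) := by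
  intro p q hpq
  have : Nontrivial P := ⟨p, q, fun e => hpq e.le⟩
  obtain ⟨x, hx, hxU⟩ := h.exists_mem_orthoDual (U := Ici p ∪ Ici (oc q))
    ((isUpperSet_Ici _).union (isUpperSet_Ici _)) (by
      have anti {a b : P} (hab : a ≤ oc b) : b ≤ oc a := by
        have := h.1 hab
        rwa [h.2.1] at this
      rintro r (hr | hr) (hr' | hr')
      · exact hpq (h.eq_bot (hr.trans (anti hr')) ▸ bot_le)
      · exact hpq (hr.trans (by simpa [h.2.1] using h.1 hr'))
      · exact hpq (hr'.trans (by simpa [h.2.1] using h.1 hr))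
      · exact hpq (h.eq_top (hr'.trans (by simpa [h.2.1] using h.1 hr)) ▸ le_top))
  refine ⟨x, hx, hxU p (Or.inl le_rfl), ?_⟩
  have := hxU (oc q) (Or.inr le_rfl)
  rw [hx q] at this
  simpa using this

theorem IsOrtho.isSeparatingSet_orthoDual [PartialOrder P] [BoundedOrder P] {oc : P → P}
    (h : IsOrtho oc) : IsSeparatingSet (OrthoDual oc) := by
  rintro I F ⟨S, hS, rfl⟩ ⟨T, hT, rfl⟩ hd
  set I : Set P := ⋂ x ∈ S, {p : P | x p = false} with hI
  set F : Set P := ⋂ x ∈ T, {p : P | x p = true} with hF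
  have mI {p : P} : p ∈ I ↔ ∀ x ∈ S, x p = false := by simp [hI]
  have mF {p : P} : p ∈ F ↔ ∀ x ∈ T, x p = true := by simp [hF]
  have hdis {p : P} (h1 : p ∈ I) (h2 : p ∈ F) : False :=
    eq_empty_iff_forall_notMem.1 hd p ⟨h1, h2⟩
  have htop {x : P →o Bool} (hx : x ∈ OrthoDual oc) : x ⊤ = true := by
    by_contra ht
    exact ht (map_eq_true_of_le x le_top (by simpa [hx ⊤] using ht : x (oc ⊤) = true))
  have hbot {x : P →o Bool} (hx : x ∈ OrthoDual oc) : x ⊥ = false := by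
    by_contra hb
    have hb' : x ⊥ = true := by simpa using hb
    have h1 := map_eq_true_of_le x (bot_le (a := oc ⊥)) hb'
    simp [hx ⊥, hb'] at h1
  have hTF : ⊤ ∈ F := mF.2 fun x hx => htop (hT hx)
  have hBI : ⊥ ∈ I := mI.2 fun x hx => hbot (hS hx)
  obtain ⟨y, hy⟩ : S.Nonempty := by
    by_contra hne
    rw [not_nonempty_iff_eq_empty] at hne
    exact hdis (mI.2 (by simp [hne])) hTF
  obtain ⟨z, hz⟩ : T.Nonempty := by
    by_contra hne
    rw [not_nonempty_iff_eq_empty] at hne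
    exact hdis hBI (mF.2 (by simp [hne]))
  have : Nontrivial P := ⟨⊥, ⊤, fun e => by
    have := hbot (hS hy)
    rw [e, htop (hS hy)] at this
    cases this⟩
  have hFup : IsUpperSet F := fun a b hab ha =>
    mF.2 fun x hx => map_eq_true_of_le x hab (mF.1 ha x hx)
  have hIlow : IsLowerSet I := fun a b hab ha => mI.2 fun x hx => by
    by_contra hb
    have := map_eq_true_of_le x hab (by simpa using hb)
    simp [mI.1 ha x hx] at this
  obtain ⟨x, hx, hxU⟩ := h.exists_mem_orthoDual (U := F ∪ oc ⁻¹' I)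
    (hFup.union fun a b hab ha => hIlow (h.1 hab) ha) (by
      rintro r (hr | hr) (hr' | hr')
      · have := mF.1 hr' z hz
        simp [hT hz r, mF.1 hr z hz] at this
      · rw [mem_preimage, h.2.1] at hr'
        exact hdis hr' hr
      · exact hdis hr hr'
      · rw [mem_preimage, h.2.1] at hr'
        have := mI.1 hr y hy
        simp [hS hy r, mI.1 hr' y hy] at this)
  refine ⟨x, hx, fun p hp => ?_, fun p hp => hxU p (Or.inl hp)⟩
  have := hxU (oc p) (Or.inr (by simpa [h.2.1] using hp))
  simpa [hx p] using this

theorem IsOrtho.C1a_eq_C2a [PartialOrder P] [BoundedOrder P] {oc : P → P}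
    (h : IsOrtho oc) : C1a (OrthoDual oc) = C2a (OrthoDual oc) := by
  have hUL : ∀ p, UPa (OrthoDual oc) p = LOa (OrthoDual oc) (oc p) := fun p => by
    ext x
    simp [UPa, LOa, x.2 p]
  have : Set.range (UPa (OrthoDual oc)) = Set.range (LOa (OrthoDual oc)) := by
    apply Subset.antisymm
    · rintro _ ⟨p, rfl⟩
      exact ⟨oc p, (hUL p).symm⟩
    · rintro _ ⟨p, rfl⟩
      exact ⟨oc p, by rw [hUL, h.2.1]⟩
  rw [C1a, C2a, this]

theorem IsOrtho.eq_of_orthoDual_subset [PartialOrder P] [BoundedOrder P] {oc oc' : P → P}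
    (h : IsOrtho oc) (hsub : OrthoDual oc ⊆ OrthoDual oc') : oc = oc' := by
  funext p
  apply le_antisymm <;> refine h.isFullSet_orthoDual.le_of_forall fun x hx hp => ?_
  · rwa [hsub hx p, ← hx p]
  · rwa [hx p, ← hsub hx p]

/-- `oc ↦ P*′` is a bijection from the set of orthocomplementations
on `P` onto the set of maximal elements (for inclusion) of the collection `𝒮` of
full separating subsets of `P*` on which the closures `C1` and `C2` coincide. -/
theorem stmt11 [PartialOrder P] [BoundedOrder P] :
    Set.BijOn (fun oc : P → P => OrthoDual oc)
      {oc : P → P | IsOrtho oc}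
      {A : Set (P →o Bool) |
        Maximal (fun A' : Set (P →o Bool) =>
          IsFullSet A' ∧ IsSeparatingSet A' ∧ C1a A' = C2a A') A} := by
  refine ⟨fun oc h => ⟨⟨h.isFullSet_orthoDual, h.isSeparatingSet_orthoDual, h.C1a_eq_C2a⟩, ?_⟩,
    fun oc h oc' _ e => IsOrtho.eq_of_orthoDual_subset h (le_of_eq e), ?_⟩
  · rintro B ⟨hf, hs, hC⟩ hsub
    obtain ⟨oc', -, hB⟩ := exists_isOrtho_subset_orthoDual hf hs hC
    rwa [← h.eq_of_orthoDual_subset (hsub.trans hB)] at hB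
  · rintro A ⟨⟨hf, hs, hC⟩, hmax⟩
    obtain ⟨oc, h, hA⟩ := exists_isOrtho_subset_orthoDual hf hs hC
    exact ⟨oc, h, (hmax ⟨h.isFullSet_orthoDual, h.isSeparatingSet_orthoDual, h.C1a_eq_C2a⟩
      hA).antisymm hA⟩
end

section
/- Let L be a distributive lattice. Then the L^{*∧∨}-ideals of L are exactly the lattice ideals of L, and the L^{*∧∨}-filters of L are exactly the lattice filters of L. -/
open Set

variable {P : Type*}

/-- `L^{*∧∨}`: the monotone maps `L → 2` preserving binary meets and joins. -/
def LatHoms (L : Type*) [Lattice L] : Set (L →o Bool) :=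
  {x | ∀ p q : L, x (p ⊓ q) = (x p && x q) ∧ x (p ⊔ q) = (x p || x q)}

/-- A lattice ideal: a lower set closed under binary joins. -/
def IsLatticeIdeal {L : Type*} [Lattice L] (I : Set L) : Prop :=
  IsLowerSet I ∧ ∀ a ∈ I, ∀ b ∈ I, a ⊔ b ∈ I

/-- A lattice filter: an upper set closed under binary meets. -/
def IsLatticeFilter {L : Type*} [Lattice L] (F : Set L) : Prop :=
  IsUpperSet F ∧ ∀ a ∈ F, ∀ b ∈ F, a ⊓ b ∈ F

theorem exists_mem_latHoms_of_disjoint {L : Type*} [DistribLattice L] {I F : Set L}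
    (hI : IsLatticeIdeal I) (hF : IsLatticeFilter F) (hFI : Disjoint F I) :
    ∃ x ∈ LatHoms L, (∀ p ∈ I, x p = false) ∧ ∀ p ∈ F, x p = true := by
  classical
  rcases I.eq_empty_or_nonempty with rfl | hIne
  · exact ⟨⟨fun _ => true, fun _ _ _ => le_rfl⟩, fun _ _ => ⟨rfl, rfl⟩, by simp, fun _ _ => rfl⟩
  rcases F.eq_empty_or_nonempty with rfl | hFne
  · exact ⟨⟨fun _ => false, fun _ _ _ => le_rfl⟩, fun _ _ => ⟨rfl, rfl⟩, fun _ _ => rfl, by simp⟩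
  let J₀ : Order.Ideal L :=
    { carrier := I
      lower' := hI.1
      nonempty' := hIne
      directed' := fun a ha b hb => ⟨a ⊔ b, hI.2 a ha b hb, le_sup_left, le_sup_right⟩ }
  have hPF : Order.IsPFilter F := Order.IsPFilter.of_def hFne
    (fun a ha b hb => ⟨a ⊓ b, hF.2 a ha b hb, inf_le_left, inf_le_right⟩)
    (fun hxy hx => hF.1 hxy hx)
  obtain ⟨J, hJ, hIJ, hFJ⟩ :=
    DistribLattice.prime_ideal_of_disjoint_filter_ideal (F := hPF.toPFilter) (I := J₀) hFI
  have hmono : Monotone fun p => decide (p ∉ J) := by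
    intro a b hab h
    simp only [decide_eq_true_eq] at h ⊢
    exact fun hb => h (J.lower hab hb)
  refine ⟨⟨fun p => decide (p ∉ J), hmono⟩, fun p q => ⟨?_, ?_⟩, fun p hp => ?_, fun p hp => ?_⟩
  · have h : p ⊓ q ∈ J ↔ p ∈ J ∨ q ∈ J :=
      ⟨hJ.mem_or_mem, fun h => h.elim (J.lower inf_le_left) (J.lower inf_le_right)⟩
    simp [h]
  · have h : p ⊔ q ∈ J ↔ p ∈ J ∧ q ∈ J := Order.Ideal.sup_mem_iff
    by_cases hp : p ∈ J <;> simp [h, hp]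
  · simpa using hIJ hp
  · simpa using Set.disjoint_left.1 hFJ hp

theorem isLatticeIdeal_Iic {L : Type*} [Lattice L] (a : L) : IsLatticeIdeal (Set.Iic a) :=
  ⟨isLowerSet_Iic a, fun _ hb _ hc => sup_le hb hc⟩

theorem isLatticeFilter_Ici {L : Type*} [Lattice L] (a : L) : IsLatticeFilter (Set.Ici a) :=
  ⟨isUpperSet_Ici a, fun _ hb _ hc => le_inf hb hc⟩

theorem IsIdealOf.isLatticeIdeal {L : Type*} [Lattice L] {I : Set L}
    (hI : IsIdealOf (LatHoms L) I) : IsLatticeIdeal I := by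
  obtain ⟨S, hS, rfl⟩ := hI
  refine ⟨isLowerSet_iInter₂ fun x _ a b hba ha => ?_, fun a ha b hb => ?_⟩
  · exact Bool.eq_false_of_le_false ((x.monotone hba).trans_eq ha)
  · simp only [Set.mem_iInter, Set.mem_ofPred_eq] at ha hb ⊢
    intro x hx
    rw [(hS hx a b).2, ha x hx, hb x hx, Bool.or_false]

theorem IsFilterOf.isLatticeFilter {L : Type*} [Lattice L] {F : Set L}
    (hF : IsFilterOf (LatHoms L) F) : IsLatticeFilter F := by
  obtain ⟨S, hS, rfl⟩ := hF
  refine ⟨isUpperSet_iInter₂ fun x _ a b hab ha => ?_, fun a ha b hb => ?_⟩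
  · exact Bool.eq_true_of_true_le (ha.symm.trans_le (x.monotone hab))
  · simp only [Set.mem_iInter, Set.mem_ofPred_eq] at ha hb ⊢
    intro x hx
    rw [(hS hx a b).1, ha x hx, hb x hx, Bool.and_true]

theorem IsLatticeIdeal.isIdealOf {L : Type*} [DistribLattice L] {I : Set L}
    (hI : IsLatticeIdeal I) : IsIdealOf (LatHoms L) I := by
  refine ⟨{x ∈ LatHoms L | ∀ p ∈ I, x p = false}, fun _ hx => hx.1, ?_⟩
  refine Set.Subset.antisymm (fun p hp => Set.mem_iInter₂.2 fun x hx => hx.2 p hp) fun a ha => ?_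
  by_contra haI
  obtain ⟨x, hx, hxI, hxa⟩ := exists_mem_latHoms_of_disjoint hI (isLatticeFilter_Ici a)
    (Set.disjoint_left.2 fun b hab hb => haI (hI.1 hab hb))
  have hxa' : x a = false := Set.mem_iInter₂.1 ha x ⟨hx, hxI⟩
  exact Bool.false_ne_true (hxa'.symm.trans (hxa a Set.self_mem_Ici))

theorem IsLatticeFilter.isFilterOf {L : Type*} [DistribLattice L] {F : Set L}
    (hF : IsLatticeFilter F) : IsFilterOf (LatHoms L) F := by
  refine ⟨{x ∈ LatHoms L | ∀ p ∈ F, x p = true}, fun _ hx => hx.1, ?_⟩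
  refine Set.Subset.antisymm (fun p hp => Set.mem_iInter₂.2 fun x hx => hx.2 p hp) fun a ha => ?_
  by_contra haF
  obtain ⟨x, hx, hxa, hxF⟩ := exists_mem_latHoms_of_disjoint (isLatticeIdeal_Iic a) hF
    (Set.disjoint_left.2 fun b hb hba => haF (hF.1 hba hb))
  have hxa' : x a = true := Set.mem_iInter₂.1 ha x ⟨hx, hxF⟩
  exact Bool.false_ne_true ((hxa a Set.self_mem_Iic).symm.trans hxa')

/-- for a distributive lattice `L`, the `L^{*∧∨}`-ideals are exactly
the lattice ideals and the `L^{*∧∨}`-filters are exactly the lattice filters. -/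
theorem stmt12 {L : Type*} [DistribLattice L] :
    (∀ I : Set L, IsIdealOf (LatHoms L) I ↔ IsLatticeIdeal I) ∧
    (∀ F : Set L, IsFilterOf (LatHoms L) F ↔ IsLatticeFilter F) :=
  ⟨fun _ => ⟨IsIdealOf.isLatticeIdeal, IsLatticeIdeal.isIdealOf⟩,
    fun _ => ⟨IsFilterOf.isLatticeFilter, IsLatticeFilter.isFilterOf⟩⟩
end

section
/- Let L be a distributive lattice and A = L^{*∧∨} with its generated closures C1 and C2. Then C1 and C2 are topological closures and the map p ↦ UP_A(p) is an order isomorphism from L onto C1O2(A, C1, C2) ordered by set inclusion. -/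
open Set

variable {P : Type*}

/-- Membership in a generated closure, tested on an indexed generating family. -/
theorem mem_closGen_range {M ι : Type*} {f : ι → Set M} {X : Set M} {z : M} :
    z ∈ closGen (Set.range f) X ↔ ∀ i, X ⊆ f i → z ∈ f i := by
  simp [closGen]

theorem subset_closGen {M : Type*} (K : Set (Set M)) (X : Set M) : X ⊆ closGen K X :=
  fun _ hz _ hk => hk.2 hz

/-- A generated closure is topological when its generating family is closed under unions. -/
theorem closGen_range_union {M ι : Type*} {f : ι → Set M}
    (hf : ∀ i j, ∃ k, f k = f i ∪ f j) (X Y : Set M) :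
    closGen (Set.range f) (X ∪ Y) = closGen (Set.range f) X ∪ closGen (Set.range f) Y := by
  ext z
  simp only [Set.mem_union, mem_closGen_range]
  constructor
  · intro h
    by_contra! hz
    obtain ⟨⟨i, hXi, hzi⟩, j, hYj, hzj⟩ := hz
    obtain ⟨k, hk⟩ := hf i j
    have hz := h k ((Set.union_subset_union hXi hYj).trans hk.superset)
    rw [hk] at hz
    exact hz.elim hzi hzj
  · rintro (h | h) i hi
    · exact h i (Set.subset_union_left.trans hi)
    · exact h i (Set.subset_union_right.trans hi)

theorem compl_LOa [PartialOrder P] (A : Set (P →o Bool)) (p : P) : (LOa A p)ᶜ = UPa A p := by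
  rw [← compl_UPa, compl_compl]

theorem UPa_mono [PartialOrder P] (A : Set (P →o Bool)) : Monotone (UPa A) :=
  fun _ _ h x hx => top_le_iff.1 (hx.symm.le.trans (x.1.monotone h))

section Lattice

variable {L : Type*}

theorem UPa_sup [Lattice L] (p q : L) :
    UPa (LatHoms L) (p ⊔ q) = UPa (LatHoms L) p ∪ UPa (LatHoms L) q := by
  ext x
  simp [UPa, (x.2 p q).2]

theorem UPa_inf [Lattice L] (p q : L) :
    UPa (LatHoms L) (p ⊓ q) = UPa (LatHoms L) p ∩ UPa (LatHoms L) q := by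
  ext x
  simp [UPa, (x.2 p q).1]

theorem LOa_sup [Lattice L] (p q : L) :
    LOa (LatHoms L) (p ⊔ q) = LOa (LatHoms L) p ∩ LOa (LatHoms L) q := by
  simp only [← compl_UPa, UPa_sup, Set.compl_union]

theorem LOa_inf [Lattice L] (p q : L) :
    LOa (LatHoms L) (p ⊓ q) = LOa (LatHoms L) p ∪ LOa (LatHoms L) q := by
  simp only [← compl_UPa, UPa_inf, Set.compl_inter]

theorem const_mem_LatHoms [Lattice L] (b : Bool) : OrderHom.const L b ∈ LatHoms L := by
  simp [LatHoms]

open Classical in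
/-- The lattice homomorphism into `Bool` vanishing exactly on a prime ideal. -/
theorem exists_latHom_of_isPrime [Lattice L] {J : Order.Ideal L} (hJ : J.IsPrime) :
    ∃ x ∈ LatHoms L, ∀ p, x p = false ↔ p ∈ J := by
  refine ⟨⟨fun p => decide (p ∉ J), fun p q hpq => ?_⟩, fun p q => ?_, fun p => by simp⟩
  · by_cases hq : q ∈ J
    · have hp : p ∈ J := J.lower hpq hq
      simp [hp]
    · simp [hq, Bool.le_true]
  · have hinf : p ⊓ q ∈ J ↔ p ∈ J ∨ q ∈ J :=
      ⟨hJ.mem_or_mem, fun h => h.elim (J.lower inf_le_left) (J.lower inf_le_right)⟩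
    constructor
    · simp [hinf]
    · by_cases hp : p ∈ J <;> simp [Order.Ideal.sup_mem_iff, hp]

/-- The prime separation theorem, allowing either of the two sets to be empty. -/
theorem exists_latHom_separating [DistribLattice L] {F I : Set L} (hF : IsUpperSet F)
    (hFinf : ∀ p ∈ F, ∀ q ∈ F, p ⊓ q ∈ F) (hI : IsLowerSet I)
    (hIsup : ∀ p ∈ I, ∀ q ∈ I, p ⊔ q ∈ I) (hFI : Disjoint F I) :
    ∃ x : LatHoms L, (∀ p ∈ F, x.1 p = true) ∧ ∀ p ∈ I, x.1 p = false := by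
  rcases F.eq_empty_or_nonempty with rfl | hFne
  · exact ⟨⟨_, const_mem_LatHoms false⟩, by simp⟩
  rcases I.eq_empty_or_nonempty with rfl | hIne
  · exact ⟨⟨_, const_mem_LatHoms true⟩, by simp⟩
  have hFil : Order.IsPFilter F := Order.IsPFilter.of_def hFne
    (fun p hp q hq => ⟨p ⊓ q, hFinf p hp q hq, inf_le_left, inf_le_right⟩)
    (fun h hp => hF h hp)
  have hId : Order.IsIdeal I := ⟨hI, hIne,
    fun p hp q hq => ⟨p ⊔ q, hIsup p hp q hq, le_sup_left, le_sup_right⟩⟩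
  obtain ⟨J, hJ, hIJ, hFJ⟩ := DistribLattice.prime_ideal_of_disjoint_filter_ideal
    (F := hFil.toPFilter) (I := hId.toIdeal) hFI
  obtain ⟨x, hx, hxJ⟩ := exists_latHom_of_isPrime hJ
  refine ⟨⟨x, hx⟩, fun p hp => ?_, fun p hp => (hxJ p).2 (hIJ hp)⟩
  exact Bool.eq_true_of_not_eq_false fun h => Set.disjoint_left.1 hFJ hp ((hxJ p).1 h)

theorem UPa_subset_iff [DistribLattice L] {p q : L} :
    UPa (LatHoms L) p ⊆ UPa (LatHoms L) q ↔ p ≤ q := by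
  refine ⟨fun h => ?_, fun h => UPa_mono _ h⟩
  by_contra hpq
  obtain ⟨x, hxp, hxq⟩ := exists_latHom_separating (isUpperSet_Ici p)
    (fun _ ha _ hb => le_inf ha hb) (isLowerSet_Iic q) (fun _ ha _ hb => sup_le ha hb)
    (Set.disjoint_left.2 fun _ ha hb => hpq (le_trans ha hb))
  exact Bool.false_ne_true ((hxq q le_rfl).symm.trans (h (hxp p le_rfl)))

theorem exists_UPa_eq_of_mem_C1O2 [DistribLattice L] {B : Set (LatHoms L)}
    (hB : B ∈ C1O2 (LatHoms L)) : ∃ p : L, UPa (LatHoms L) p = B := by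
  by_contra! hne
  obtain ⟨x, hxF, hxI⟩ := exists_latHom_separating
    (F := {p | B ⊆ UPa (LatHoms L) p}) (I := {p | Bᶜ ⊆ LOa (LatHoms L) p})
    (fun _ _ h hp => hp.trans (UPa_mono _ h))
    (fun p hp q hq => (Set.subset_inter hp hq).trans (UPa_inf p q).superset)
    (fun p q h hp => by
      have hpq := Set.compl_subset_compl.2 (UPa_mono (LatHoms L) h)
      rw [compl_UPa, compl_UPa] at hpq
      exact hp.trans hpq)
    (fun p hp q hq => (Set.subset_inter hp hq).trans (LOa_sup p q).superset)
    (Set.disjoint_left.2 fun p hp hp' => hne p <| by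
      refine Set.Subset.antisymm ?_ hp
      rw [← compl_LOa]
      exact Set.compl_subset_comm.1 hp')
  have hxB : x ∈ B := hB.1 ▸ mem_closGen_range.2 hxF
  have hxB' : x ∈ Bᶜ := hB.2 ▸ mem_closGen_range.2 hxI
  exact hxB' hxB

end Lattice

/-- for a distributive lattice `L` and `A = L^{*∧∨}`, the closures
`C1`, `C2` are topological and `p ↦ UP_A(p)` is an order isomorphism from `L` onto
`C1O2(A, C1, C2)` ordered by set inclusion. -/
theorem stmt15 {L : Type*} [DistribLattice L] :
    (∀ X Y : Set ↥(LatHoms L), C1a (LatHoms L) (X ∪ Y) = C1a (LatHoms L) X ∪ C1a (LatHoms L) Y) ∧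
    (∀ X Y : Set ↥(LatHoms L), C2a (LatHoms L) (X ∪ Y) = C2a (LatHoms L) X ∪ C2a (LatHoms L) Y) ∧
    (∀ p : L, UPa (LatHoms L) p ∈ C1O2 (LatHoms L)) ∧
    Function.Injective (UPa (LatHoms L)) ∧
    (∀ B ∈ C1O2 (LatHoms L), ∃ p : L, UPa (LatHoms L) p = B) ∧
    (∀ p q : L, p ≤ q ↔ UPa (LatHoms L) p ⊆ UPa (LatHoms L) q) := by
  refine ⟨closGen_range_union fun p q => ⟨p ⊔ q, UPa_sup p q⟩,
    closGen_range_union fun p q => ⟨p ⊓ q, LOa_inf p q⟩, UPa_mem_C1O2 _, fun p q h => ?_,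
    fun _ => exists_UPa_eq_of_mem_C1O2, fun _ _ => UPa_subset_iff.symm⟩
  exact (UPa_subset_iff.1 h.subset).antisymm (UPa_subset_iff.1 h.superset)
end

section
/- A lattice L is distributive if and only if L^{*∧∨} is a full and separating subset of L*. -/
open Set

variable {P : Type*}

/-- Disjoint ideals and filters of a distributive lattice are separated by a lattice
homomorphism to the two-element chain. -/
theorem DistribLattice.exists_latHom_of_disjoint {L : Type*} [DistribLattice L]
    {F : Order.PFilter L} {I : Order.Ideal L} (h : Disjoint (F : Set L) (I : Set L)) :
    ∃ x ∈ LatHoms L, (∀ p ∈ I, x p = false) ∧ (∀ p ∈ F, x p = true) := by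
  classical
  obtain ⟨J, hJ, hIJ, hFJ⟩ := DistribLattice.prime_ideal_of_disjoint_filter_ideal h
  have hinf : ∀ p q : L, p ⊓ q ∈ J ↔ p ∈ J ∨ q ∈ J := fun p q =>
    ⟨fun hpq => hJ.mem_or_mem hpq,
      fun hpq => hpq.elim (J.lower inf_le_left) (J.lower inf_le_right)⟩
  refine ⟨⟨fun p => decide (p ∉ J), fun p q hpq => ?_⟩, fun p q => ⟨?_, ?_⟩,
    fun p hp => ?_, fun p hp => ?_⟩
  · rw [Bool.le_iff_imp]
    simpa using fun hp hq => hp (J.lower hpq hq)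
  · simp [hinf]
  · simp [Order.Ideal.sup_mem_iff]
  · simpa using hIJ hp
  · simpa using Set.disjoint_left.mp hFJ hp

theorem isFullSet_latHoms (L : Type*) [DistribLattice L] : IsFullSet (LatHoms L) := by
  intro p q hpq
  obtain ⟨x, hx, h0, h1⟩ := DistribLattice.exists_latHom_of_disjoint
    (F := Order.PFilter.principal p) (I := Order.Ideal.principal q)
    (Set.disjoint_left.mpr fun r hr hr' => hpq
      (le_trans (Order.PFilter.mem_principal.mp hr) (Order.Ideal.mem_principal.mp hr')))
  exact ⟨x, hx, h1 p (Order.PFilter.mem_principal.mpr le_rfl),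
    h0 q (Order.Ideal.mem_principal.mpr le_rfl)⟩

theorem isSeparatingSet_latHoms (L : Type*) [DistribLattice L] :
    IsSeparatingSet (LatHoms L) := by
  rintro _ _ ⟨S, hS, rfl⟩ ⟨T, hT, rfl⟩ hdisj
  set I : Set L := ⋂ x ∈ S, {p : L | x p = false} with hI
  set F : Set L := ⋂ x ∈ T, {p : L | x p = true} with hF
  have memI : ∀ p, p ∈ I ↔ ∀ x ∈ S, x p = false := fun p => by simp [hI]
  have memF : ∀ p, p ∈ F ↔ ∀ x ∈ T, x p = true := fun p => by simp [hF]
  rcases I.eq_empty_or_nonempty with hI0 | hI0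
  · exact ⟨⟨fun _ => true, fun _ _ _ => le_rfl⟩, fun _ _ => ⟨rfl, rfl⟩,
      fun p hp => absurd hp (by simp [hI0]), fun _ _ => rfl⟩
  rcases F.eq_empty_or_nonempty with hF0 | hF0
  · exact ⟨⟨fun _ => false, fun _ _ _ => le_rfl⟩, fun _ _ => ⟨rfl, rfl⟩,
      fun _ _ => rfl, fun p hp => absurd hp (by simp [hF0])⟩
  have isIdeal : Order.IsIdeal I :=
    { IsLowerSet := fun p q hqp hp => (memI q).mpr fun x hx =>
        le_bot_iff.mp ((x.monotone hqp).trans_eq ((memI p).mp hp x hx))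
      Nonempty := hI0
      Directed := fun p hp q hq => ⟨p ⊔ q, (memI _).mpr fun x hx => by
        rw [(hS hx p q).2, (memI p).mp hp x hx, (memI q).mp hq x hx]; rfl,
        le_sup_left, le_sup_right⟩ }
  have isPFilter : Order.IsPFilter F := Order.IsPFilter.of_def hF0
    (fun p hp q hq => ⟨p ⊓ q, (memF _).mpr fun x hx => by
      rw [(hT hx p q).1, (memF p).mp hp x hx, (memF q).mp hq x hx]; rfl,
      inf_le_left, inf_le_right⟩)
    (fun {p q} hpq hp => (memF q).mpr fun x hx =>
      top_le_iff.mp (((memF p).mp hp x hx).symm.trans_le (x.monotone hpq)))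
  exact DistribLattice.exists_latHom_of_disjoint (F := isPFilter.toPFilter)
    (I := isIdeal.toIdeal)
    (Set.disjoint_iff_inter_eq_empty.mpr ((Set.inter_comm F I).trans hdisj))

theorem IsFullSet.inf_sup_left {L : Type*} [Lattice L] (h : IsFullSet (LatHoms L))
    (a b c : L) : a ⊓ (b ⊔ c) = (a ⊓ b) ⊔ (a ⊓ c) := by
  refine le_antisymm (by_contra fun hle => ?_) le_inf_sup
  obtain ⟨x, hx, h1, h0⟩ := h _ _ hle
  rw [(hx _ _).1, (hx _ _).2, Bool.and_or_distrib_left, ← (hx _ _).1, ← (hx _ _).1,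
    ← (hx _ _).2, h0] at h1
  exact Bool.false_ne_true h1

/-- a lattice `L` is distributive iff `L^{*∧∨}` is a full and
separating subset of `L*`. -/
theorem stmt16 {L : Type*} [Lattice L] :
    (∀ a b c : L, a ⊓ (b ⊔ c) = (a ⊓ b) ⊔ (a ⊓ c)) ↔
      (IsFullSet (LatHoms L) ∧ IsSeparatingSet (LatHoms L)) := by
  refine ⟨fun h => ?_, fun h => h.1.inf_sup_left⟩
  let _ : DistribLattice L := DistribLattice.ofInfSupLe fun a b c => (h a b c).le
  exact ⟨isFullSet_latHoms L, isSeparatingSet_latHoms L⟩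
end

section
/- Let L be a bounded distributive lattice. Then L is a Boolean algebra (i.e., every element of L has a complement) if and only if the closures C1 and C2 generated on L^{*∧∨} \ {𝟎, 𝟏} coincide. -/
open Set

variable {P : Type*}

section

variable {L : Type*}

lemma latHom_bot [Lattice L] [BoundedOrder L] {x : L →o Bool}
    (hx : x ∈ LatHoms L \ {OrderHom.const L false, OrderHom.const L true}) :
    x ⊥ = false := by
  by_contra h
  refine hx.2 (Or.inr (OrderHom.ext _ _ (funext fun p => ?_)))
  have hp : x ⊥ ≤ x p := x.monotone bot_le
  rw [Bool.not_eq_false] at h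
  exact hp h

lemma latHom_top [Lattice L] [BoundedOrder L] {x : L →o Bool}
    (hx : x ∈ LatHoms L \ {OrderHom.const L false, OrderHom.const L true}) :
    x ⊤ = true := by
  by_contra h
  refine hx.2 (Or.inl (OrderHom.ext _ _ (funext fun p => ?_)))
  have hp : x p ≤ x ⊤ := x.monotone le_top
  rw [Bool.not_eq_true] at h
  exact Bool.eq_false_of_le_false (h ▸ hp)

/-- A point outside an ideal is separated from it by a nonconstant lattice homomorphism to `2`. -/
lemma exists_latHom_of_notMem_ideal [DistribLattice L] [BoundedOrder L] (I : Order.Ideal L)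
    {a : L} (ha : a ∉ I) :
    ∃ x ∈ LatHoms L \ {OrderHom.const L false, OrderHom.const L true},
      x a = true ∧ ∀ r ∈ I, x r = false := by
  classical
  have hdisj : Disjoint (Order.PFilter.principal a : Set L) (I : Set L) :=
    Set.disjoint_left.2 fun r hr hrI => ha (I.lower (Order.PFilter.mem_principal.1 hr) hrI)
  obtain ⟨J, hJ, hIJ, hFJ⟩ := DistribLattice.prime_ideal_of_disjoint_filter_ideal hdisj
  have haJ : a ∉ J := Set.disjoint_left.1 hFJ (Order.PFilter.mem_principal.2 le_rfl)
  let x : L →o Bool :=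
    { toFun := fun p => decide (p ∉ J)
      monotone' := fun p q hpq hp => by
        simp only [decide_eq_true_eq] at hp ⊢
        exact fun hq => hp (J.lower hpq hq) }
  have hx (p : L) : x p = decide (p ∉ J) := rfl
  refine ⟨x, ⟨fun p q => ⟨?_, ?_⟩, ?_⟩, by simp [hx, haJ], fun r hr => by simp [hx, hIJ hr]⟩
  · have : p ⊓ q ∈ J ↔ p ∈ J ∨ q ∈ J :=
      ⟨hJ.mem_or_mem, fun h => h.elim (J.lower inf_le_left) (J.lower inf_le_right)⟩
    simp [hx, this]
  · simp only [hx, Order.Ideal.sup_mem_iff, not_and_or, Bool.decide_or]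
  · rintro (h | h)
    · have := DFunLike.congr_fun h a
      simp [hx, haJ] at this
    · have := DFunLike.congr_fun h ⊥
      simp [hx] at this

/-- The ideal of elements below `p ⊔ q` for some `q` disjoint from `p`. -/
def supDisjointIdeal [DistribLattice L] [BoundedOrder L] (p : L) : Order.Ideal L where
  carrier := {r | ∃ q, p ⊓ q = ⊥ ∧ r ≤ p ⊔ q}
  lower' := fun _ _ hsr ⟨q, hq, hr⟩ => ⟨q, hq, hsr.trans hr⟩
  nonempty' := ⟨⊥, ⊥, inf_bot_eq p, bot_le⟩
  directed' := by
    rintro r ⟨q, hq, hr⟩ s ⟨t, ht, hs⟩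
    refine ⟨r ⊔ s, ⟨q ⊔ t, by rw [inf_sup_left, hq, ht, sup_bot_eq], ?_⟩,
      le_sup_left, le_sup_right⟩
    exact sup_le (hr.trans (sup_le_sup_left le_sup_left p))
      (hs.trans (sup_le_sup_left le_sup_right p))

lemma UPa_eq_LOa_of_complement [Lattice L] [BoundedOrder L] {p q : L}
    (hinf : p ⊓ q = ⊥) (hsup : p ⊔ q = ⊤) :
    UPa (LatHoms L \ {OrderHom.const L false, OrderHom.const L true}) p =
      LOa (LatHoms L \ {OrderHom.const L false, OrderHom.const L true}) q := by
  ext ⟨x, hx⟩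
  have h0 := (hx.1 p q).1
  have h1 := (hx.1 p q).2
  rw [hinf, latHom_bot hx] at h0
  rw [hsup, latHom_top hx] at h1
  change x p = true ↔ x q = false
  generalize x p = a at *
  generalize x q = b at *
  revert a b
  decide

end

/-- a bounded distributive lattice `L` is a Boolean algebra (every
element has a complement) iff the closures `C1` and `C2` generated on
`L^{*∧∨} \ {𝟎, 𝟏}` coincide. -/
theorem stmt19 {L : Type*} [DistribLattice L] [BoundedOrder L] :
    (∀ p : L, ∃ q : L, p ⊓ q = ⊥ ∧ p ⊔ q = ⊤) ↔
      C1a (LatHoms L \ {OrderHom.const L false, OrderHom.const L true}) =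
        C2a (LatHoms L \ {OrderHom.const L false, OrderHom.const L true}) := by
  constructor
  · intro h
    unfold C1a C2a
    congr 1
    ext k
    constructor
    · rintro ⟨p, rfl⟩
      obtain ⟨q, hinf, hsup⟩ := h p
      exact ⟨q, (UPa_eq_LOa_of_complement hinf hsup).symm⟩
    · rintro ⟨p, rfl⟩
      obtain ⟨q, hinf, hsup⟩ := h p
      exact ⟨q, UPa_eq_LOa_of_complement (inf_comm p q ▸ hinf) (sup_comm p q ▸ hsup)⟩
  · intro h p
    by_cases htop : ⊤ ∈ supDisjointIdeal p
    · obtain ⟨q, hq, hle⟩ := htop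
      exact ⟨q, hq, top_le_iff.1 hle⟩
    · exfalso
      obtain ⟨x, hx, -, hxI⟩ := exists_latHom_of_notMem_ideal _ htop
      have hxp : x p = false := hxI p ⟨⊥, inf_bot_eq p, le_sup_left⟩
      have hmem : (⟨x, hx⟩ : ↥(LatHoms L \ {OrderHom.const L false, OrderHom.const L true})) ∈
          C2a _ (UPa _ p) := by
        rintro _ ⟨⟨q, rfl⟩, hsub⟩
        refine hxI q ⟨q, ?_, le_sup_right⟩
        by_contra hne
        obtain ⟨y, hy, hya, -⟩ := exists_latHom_of_notMem_ideal
          (Order.Ideal.principal (⊥ : L)) (a := p ⊓ q)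
          (fun hm => hne (le_bot_iff.1 (Order.Ideal.mem_principal.1 hm)))
        rw [(hy.1 p q).1, Bool.and_eq_true] at hya
        have hyq : y q = false :=
          hsub (show (⟨y, hy⟩ : ↥(LatHoms L \ _)) ∈ UPa _ p from hya.1)
        exact Bool.false_ne_true (hyq.symm.trans hya.2)
      rw [← h] at hmem
      have hxp' : x p = true := hmem (UPa _ p) ⟨⟨p, rfl⟩, subset_rfl⟩
      exact Bool.false_ne_true (hxp.symm.trans hxp')
end
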